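/- Let φ : ℝ × ℝ → ℝ be smooth with φ_x nowhere zero, satisfying the KdV singularity manifold equation φ_t = φ_x {φ; x} at every point, where {φ; x} = (φ_xx/φ_x)_x − (1/2)(φ_xx/φ_x)². Let a, b, c, d be real numbers with ad − bc ≠ 0 and suppose cφ + d is nowhere zero. Then φ̂ := (aφ + b)/(cφ + d) is smooth, φ̂_x is nowhere zero, and φ̂ satisfies the KdV singularity manifold equation φ̂_t = φ̂_x {φ̂; x} at every point. -/

import Mathlib

/-- Partial derivative with respect to the first (space) variable. -/
noncomputable def px (f : ℝ × ℝ → ℝ) : ℝ × ℝ → ℝ :=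
  fun p => deriv (fun x => f (x, p.2)) p.1

/-- Partial derivative with respect to the second (time) variable. -/
noncomputable def pt (f : ℝ × ℝ → ℝ) : ℝ × ℝ → ℝ :=
  fun p => deriv (fun t => f (p.1, t)) p.2

/-- Schwarzian derivative of `f` with respect to the space variable:
`{f; x} = (f_xx / f_x)_x - (1/2) (f_xx / f_x)²`. -/
noncomputable def schwarz (f : ℝ × ℝ → ℝ) : ℝ × ℝ → ℝ :=
  fun p => px (fun q => px (px f) q / px f q) p - (1/2) * (px (px f) p / px f p) ^ 2


/-- The `x`-slice of a smooth function has derivative `px f`. -/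
theorem hasDerivAt_px {f : ℝ × ℝ → ℝ} (hf : ContDiff ℝ (⊤ : ℕ∞) f) (p : ℝ × ℝ) :
    HasDerivAt (fun x => f (x, p.2)) (px f p) p.1 := by
  have h : Differentiable ℝ f := hf.differentiable (by simp)
  have h' : Differentiable ℝ (fun x : ℝ => f (x, p.2)) := by fun_prop
  exact (h' p.1).hasDerivAt

/-- The `t`-slice of a smooth function has derivative `pt f`. -/
theorem hasDerivAt_pt {f : ℝ × ℝ → ℝ} (hf : ContDiff ℝ (⊤ : ℕ∞) f) (p : ℝ × ℝ) :
    HasDerivAt (fun t => f (p.1, t)) (pt f p) p.2 := by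
  have h : Differentiable ℝ f := hf.differentiable (by simp)
  have h' : Differentiable ℝ (fun t : ℝ => f (p.1, t)) := by fun_prop
  exact (h' p.2).hasDerivAt

theorem ContDiff.px {f : ℝ × ℝ → ℝ} (hf : ContDiff ℝ (⊤ : ℕ∞) f) :
    ContDiff ℝ (⊤ : ℕ∞) (px f) := by
  have key : _root_.px f = fun p => fderiv ℝ f p (1, 0) := by
    funext p
    have h : HasFDerivAt f (fderiv ℝ f p) (p.1, p.2) :=
      (hf.differentiable (by simp) p).hasFDerivAt
    exact (h.comp_hasDerivAt p.1
      ((hasDerivAt_id p.1).prodMk (hasDerivAt_const p.1 p.2))).deriv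
  rw [key]
  exact (hf.fderiv_right (m := (⊤ : ℕ∞)) (by simp)).clm_apply contDiff_const

/-- Derivative of a Möbius transform of a function of one variable. -/
theorem HasDerivAt.moebius {u : ℝ → ℝ} {u' x : ℝ} (hu : HasDerivAt u u' x)
    (a b c d : ℝ) (h : c * u x + d ≠ 0) :
    HasDerivAt (fun y => (a * u y + b) / (c * u y + d))
      ((a * d - b * c) * u' / (c * u x + d) ^ 2) x := by
  refine (((hu.const_mul a).add_const b).div ((hu.const_mul c).add_const d) h).congr_deriv ?_
  ring

theorem px_moebius {φ : ℝ × ℝ → ℝ} (hφ : ContDiff ℝ (⊤ : ℕ∞) φ) {a b c d : ℝ}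
    (hcφd : ∀ p, c * φ p + d ≠ 0) :
    px (fun q => (a * φ q + b) / (c * φ q + d)) =
      fun p => (a * d - b * c) * px φ p / (c * φ p + d) ^ 2 :=
  funext fun p => ((hasDerivAt_px hφ p).moebius a b c d (hcφd p)).deriv

theorem pt_moebius {φ : ℝ × ℝ → ℝ} (hφ : ContDiff ℝ (⊤ : ℕ∞) φ) {a b c d : ℝ}
    (hcφd : ∀ p, c * φ p + d ≠ 0) (p : ℝ × ℝ) :
    pt (fun q => (a * φ q + b) / (c * φ q + d)) p =
      (a * d - b * c) * pt φ p / (c * φ p + d) ^ 2 :=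
  ((hasDerivAt_pt hφ p).moebius a b c d (hcφd p)).deriv

theorem px_px_moebius {φ : ℝ × ℝ → ℝ} (hφ : ContDiff ℝ (⊤ : ℕ∞) φ) {a b c d : ℝ}
    (hcφd : ∀ p, c * φ p + d ≠ 0) :
    px (px (fun q => (a * φ q + b) / (c * φ q + d))) =
      fun p => (a * d - b * c) *
        (px (px φ) p / (c * φ p + d) ^ 2 - 2 * c * px φ p ^ 2 / (c * φ p + d) ^ 3) := by
  rw [px_moebius hφ hcφd]
  funext p
  have hw := hcφd p
  have h := ((hasDerivAt_px hφ.px p).const_mul (a * d - b * c)).div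
    ((((hasDerivAt_px hφ p).const_mul c).add_const d).pow 2) (pow_ne_zero 2 hw)
  refine h.deriv.trans ?_
  simp only [Pi.pow_apply, Prod.mk.eta]
  field_simp
  ring

/-- The Schwarzian derivative is invariant under Möbius transformations. -/
theorem schwarz_moebius {φ : ℝ × ℝ → ℝ} (hφ : ContDiff ℝ (⊤ : ℕ∞) φ) {a b c d : ℝ}
    (hcφd : ∀ p, c * φ p + d ≠ 0)
    (hφx : ∀ p, px φ p ≠ 0) (habcd : a * d - b * c ≠ 0) (p : ℝ × ℝ) :
    schwarz (fun q => (a * φ q + b) / (c * φ q + d)) p = schwarz φ p := by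
  have hratio : ∀ q, px (px (fun q => (a * φ q + b) / (c * φ q + d))) q /
      px (fun q => (a * φ q + b) / (c * φ q + d)) q =
      px (px φ) q / px φ q - 2 * c * px φ q / (c * φ q + d) := by
    intro q
    rw [px_px_moebius hφ hcφd, px_moebius hφ hcφd]
    have hw := hcφd q
    have hx := hφx q
    field_simp
  have hw := hcφd p
  have hx := hφx p
  have hR := hasDerivAt_px (f := fun q => px (px φ) q / px φ q) (hφ.px.px.div hφ.px hφx) p
  have hQ := ((hasDerivAt_px hφ.px p).const_mul (2 * c)).div
    (((hasDerivAt_px hφ p).const_mul c).add_const d) hw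
  have hpx : px (fun q => px (px φ) q / px φ q - 2 * c * px φ q / (c * φ q + d)) p = _ :=
    (hR.sub hQ).deriv
  simp only [schwarz, hratio, hpx, Prod.mk.eta]
  field_simp
  ring

/-- Möbius invariance of the KdV singularity manifold equation: if `φ` solves
`φ_t = φ_x {φ; x}` with `φ_x` nowhere zero, `ad - bc ≠ 0` and `cφ + d` is nowhere zero,
then `φ̂ := (aφ + b)/(cφ + d)` is smooth, has nowhere-zero `x`-derivative, and solves the
KdV singularity manifold equation. -/
theorem kdvSing_moebius_invariance
    (φ : ℝ × ℝ → ℝ) (hφ : ContDiff ℝ (⊤ : ℕ∞) φ) (hφx : ∀ p, px φ p ≠ 0)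
    (hsing : ∀ p, pt φ p = px φ p * schwarz φ p)
    (a b c d : ℝ) (habcd : a * d - b * c ≠ 0)
    (hcφd : ∀ p, c * φ p + d ≠ 0) :
    ContDiff ℝ (⊤ : ℕ∞) (fun q => (a * φ q + b) / (c * φ q + d)) ∧
    (∀ p, px (fun q => (a * φ q + b) / (c * φ q + d)) p ≠ 0) ∧
    (∀ p, pt (fun q => (a * φ q + b) / (c * φ q + d)) p =
        px (fun q => (a * φ q + b) / (c * φ q + d)) p *
          schwarz (fun q => (a * φ q + b) / (c * φ q + d)) p) := by
  refine ⟨?_, fun p => ?_, fun p => ?_⟩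
  · exact ((contDiff_const.mul hφ).add contDiff_const).div
      ((contDiff_const.mul hφ).add contDiff_const) hcφd
  · rw [px_moebius hφ hcφd]
    exact div_ne_zero (mul_ne_zero habcd (hφx p)) (pow_ne_zero 2 (hcφd p))
  · rw [schwarz_moebius hφ hcφd hφx habcd, px_moebius hφ hcφd, pt_moebius hφ hcφd, hsing p]
    ring
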